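/- With the standard sequential composition semantics, the guarded recursive specification X = a.X·Y + b.1, Y = c.1 + 1 generates an unboundedly branching transition system: for every n ≥ 1, the state Y^n has exactly n distinct c-labelled transitions, to 1, Y, Y², …, Y^{n-1}. -/

import Mathlib

namespace Stmt11

/-- Process expressions over an action alphabet `A`, with a name `X` for the
recursive specification `X = a.(X·Y) + b.1`, `Y = c.1 + 1`. -/
inductive Pr (A : Type) : Type
  | zero : Pr A
  | one : Pr A
  | act : A → Pr A → Pr A
  | seq : Pr A → Pr A → Pr A
  | alt : Pr A → Pr A → Pr A
  | X : Pr A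

variable {A : Type}

/-- The process `Y = c.1 + 1`. -/
def Yp (lc : A) : Pr A := Pr.alt (Pr.act lc Pr.one) Pr.one

/-- Termination predicate (note `X = a.(X·Y) + b.1` does not terminate). -/
def Pr.term : Pr A → Prop
  | .zero => False
  | .one => True
  | .act _ _ => False
  | .seq p q => p.term ∧ q.term
  | .alt p q => p.term ∨ q.term
  | .X => False

/-- The transition relation under the *standard* (transparent) semantics of
sequential composition, with the name `X` unfolding to `a.(X·Y) + b.1`. -/
def Tr (la lb lc : A) : Pr A → A → Pr A → Prop
  | .zero, _, _ => False
  | .one, _, _ => False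
  | .act a p, b, r => b = a ∧ r = p
  | .alt p q, a, r => Tr la lb lc p a r ∨ Tr la lb lc q a r
  | .seq p q, a, r =>
      (∃ p', Tr la lb lc p a p' ∧ r = .seq p' q) ∨
      (p.term ∧ Tr la lb lc q a r)
  | .X, a, r => (a = la ∧ r = .seq .X (Yp lc)) ∨ (a = lb ∧ r = .one)

/-- `Y^n`: `Y^0 = 1` and `Y^{n+1} = Y · Y^n`. -/
def Ypow (lc : A) : ℕ → Pr A
  | 0 => Pr.one
  | n + 1 => Pr.seq (Yp lc) (Ypow lc n)

/-- Strong bisimulations. -/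
def IsStrongBisim (la lb lc : A) (R : Pr A → Pr A → Prop) : Prop :=
  Symmetric R ∧ ∀ p q, R p q →
    (∀ a p', Tr la lb lc p a p' → ∃ q', Tr la lb lc q a q' ∧ R p' q') ∧
    (p.term → q.term)

/-- Strong bisimilarity. -/
def StrongBisimilar (la lb lc : A) (p q : Pr A) : Prop :=
  ∃ R, IsStrongBisim la lb lc R ∧ R p q

theorem tr_Ypow_iff (la lb lc : A) (n : ℕ) (a : A) (q : Pr A) :
    Tr la lb lc (Ypow lc n) a q ↔
      (a = lc ∧ ∃ k < n, q = Pr.seq Pr.one (Ypow lc k)) := by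
  induction n with
  | zero => simp [Ypow, Tr]
  | succ n ih =>
    simp only [Ypow, Tr, Yp, Pr.term, ih, or_false, false_or, true_and]
    constructor
    · rintro (⟨_, ⟨rfl, rfl⟩, rfl⟩ | ⟨rfl, k, hk, rfl⟩)
      · exact ⟨rfl, n, n.lt_succ_self, rfl⟩
      · exact ⟨rfl, k, hk.trans n.lt_succ_self, rfl⟩
    · rintro ⟨rfl, k, hk, rfl⟩
      rcases Nat.lt_succ_iff_lt_or_eq.mp hk with h | rfl
      · exact Or.inr ⟨rfl, k, h, rfl⟩
      · exact Or.inl ⟨_, ⟨rfl, rfl⟩, rfl⟩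

theorem Ypow_injective (lc : A) : Function.Injective (Ypow lc) := by
  intro m
  induction m with
  | zero =>
    intro n h
    cases n with
    | zero => rfl
    | succ n => cases h
  | succ m ih =>
    intro n h
    cases n with
    | zero => cases h
    | succ n => exact congrArg Nat.succ (ih (Pr.seq.inj h).2)

theorem tr_one_seq_iff (la lb lc : A) (p : Pr A) (a : A) (q : Pr A) :
    Tr la lb lc (Pr.seq Pr.one p) a q ↔ Tr la lb lc p a q := by
  simp [Tr, Pr.term]

theorem term_one_seq_iff (p : Pr A) : (Pr.seq Pr.one p).term ↔ p.term := by
  simp [Pr.term]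

theorem strongBisimilar_one_seq (la lb lc : A) (p : Pr A) :
    StrongBisimilar la lb lc (Pr.seq Pr.one p) p := by
  refine ⟨fun p q => p = q ∨ p = Pr.seq Pr.one q ∨ q = Pr.seq Pr.one p,
    ⟨?_, ?_⟩, Or.inr (Or.inl rfl)⟩
  · rintro p q (h | h | h)
    · exact Or.inl h.symm
    · exact Or.inr (Or.inr h)
    · exact Or.inr (Or.inl h)
  · rintro p q (rfl | rfl | rfl)
    · exact ⟨fun a r h => ⟨r, h, Or.inl rfl⟩, id⟩
    · exact ⟨fun a r h => ⟨r, (tr_one_seq_iff ..).mp h, Or.inl rfl⟩,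
        (term_one_seq_iff _).mp⟩
    · exact ⟨fun a r h => ⟨r, (tr_one_seq_iff ..).mpr h, Or.inl rfl⟩,
        (term_one_seq_iff _).mpr⟩

/-- With the standard (transparent) sequential composition, the specification
`X = a.X·Y + b.1`, `Y = c.1 + 1` is unboundedly branching: for every `n ≥ 1`,
the state `Y^n` has exactly `n` distinct `c`-labelled transitions, to states
(strongly bisimilar to) `1, Y, Y², …, Y^{n-1}`. -/
theorem transparent_unbounded_branching {A : Type} (la lb lc : A)
    (n : ℕ) (hn : 1 ≤ n) :
    (∀ a q, Tr la lb lc (Ypow lc n) a q ↔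
      (a = lc ∧ ∃ k < n, q = Pr.seq Pr.one (Ypow lc k))) ∧
    {q : Pr A | Tr la lb lc (Ypow lc n) lc q}.ncard = n ∧
    (∀ k < n, StrongBisimilar la lb lc (Pr.seq Pr.one (Ypow lc k))
      (Ypow lc k)) := by
  refine ⟨tr_Ypow_iff la lb lc n, ?_, fun k _ => strongBisimilar_one_seq la lb lc _⟩
  have h : {q : Pr A | Tr la lb lc (Ypow lc n) lc q} =
      (fun k => Pr.seq Pr.one (Ypow lc k)) '' (Finset.range n : Set ℕ) := by
    ext q
    simp [tr_Ypow_iff, eq_comm]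
  rw [h, Set.ncard_image_of_injective, Set.ncard_coe_finset, Finset.card_range]
  intro i j hij
  exact Ypow_injective lc (Pr.seq.inj hij).2

end Stmt11
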